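/- arXiv:0710.4284 — 7 statements merged into one kernel-verified Lean document; each statement's English description precedes it below -/
import Mathlib

section
/- If a, x, c are integers with a ≥ 6, x ≥ 1, c ≥ 0, x² ≥ ac, and 2ax + x² + 2ac − 6a − 11x − 3c = 0, then (a, x, c) = (14, 4, 0). -/
theorem stmt_2 (a x c : ℤ) (ha : a ≥ 6) (hx : x ≥ 1) (hc : c ≥ 0)
    (hodge : x^2 ≥ a*c)
    (heq : 2*a*x + x^2 + 2*a*c - 6*a - 11*x - 3*c = 0) :
    (a, x, c) = (14, 4, 0) := by
  have hx5 : x ≤ 5 := by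
    by_contra! h
    nlinarith [mul_nonneg (sub_nonneg.2 ha) (by linarith : (0 : ℤ) ≤ x - 3),
      mul_nonneg (sub_nonneg.2 ha) hc]
  have hc4 : c ≤ 4 := by
    by_contra! h
    nlinarith [mul_nonneg (sub_nonneg.2 ha) hc]
  simp only [Prod.mk.injEq]
  interval_cases x <;> interval_cases c <;> omega
end

section
/- For integers a, b, c, d with a ≥ 4, b ≥ 3, c ≥ 0 and d ≥ b, the equation 2ab + 2bc + 2ad − 8a − 7b − 6c − 3d = 0 holds if and only if (a, b, c, d) = (4, 4, 4, 4) or (a, b, c, d) = (5, 4, 0, 4). -/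
theorem stmt_4 (a b c d : ℤ) (ha : a ≥ 4) (hb : b ≥ 3) (hc : c ≥ 0) (hd : d ≥ b) :
    2*a*b + 2*b*c + 2*a*d - 8*a - 7*b - 6*c - 3*d = 0 ↔
      (a, b, c, d) = (4, 4, 4, 4) ∨ (a, b, c, d) = (5, 4, 0, 4) := by
  simp only [Prod.mk.injEq]
  constructor
  · intro h
    have hbc : 0 ≤ (b - 3) * c := mul_nonneg (by linarith) hc
    have had : 0 ≤ (2 * a - 3) * (d - b) := mul_nonneg (by linarith) (by linarith)
    have hb5 : b ≤ 5 := by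
      by_contra! hlt
      nlinarith [mul_nonneg (show 0 ≤ a - 4 by linarith) (show 0 ≤ b - 6 by linarith)]
    have ha7 : a ≤ 7 := by
      interval_cases b <;> linarith
    interval_cases b <;> interval_cases a <;> omega
  · rintro (⟨rfl, rfl, rfl, rfl⟩ | ⟨rfl, rfl, rfl, rfl⟩) <;> norm_num
end

section
/- If a, b, c, d are integers with a ≥ 3, b ≥ c ≥ 0, b + c ≥ 1, d ≥ a and a² + 2ab + 2ac + 2bc + 2ad − 12a − 7b − 7c − 3d = 0, then a ≤ 4. -/
theorem stmt_5 (a b c d : ℤ) (ha : a ≥ 3) (hbc : b ≥ c) (hc : c ≥ 0)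
    (hbc1 : b + c ≥ 1) (hd : d ≥ a)
    (heq : a^2 + 2*a*b + 2*a*c + 2*b*c + 2*a*d - 12*a - 7*b - 7*c - 3*d = 0) :
    a ≤ 4 := by
  by_contra! h
  have h₁ : 0 ≤ (2 * a - 3) * (d - a) := mul_nonneg (by linarith) (by linarith)
  have h₂ : 0 ≤ a * (a - 5) := mul_nonneg (by linarith) (by linarith)
  have h₃ : 0 < (2 * a - 7) * (b + c) := mul_pos (by linarith) (by linarith)
  have h₄ : 0 ≤ b * c := mul_nonneg (by linarith) hc
  linarith
end

section
/- For integers x, y, f with x > 0, y > 0 and f < 0, the equation y(y − 7) + x(2y − 5) + (−f)(2y − 4) + 2(−f)x = 0 holds if and only if (x, y, f) is one of (2, 1, −6), (4, 1, −3), (10, 1, −2), (2, 2, −3), (10, 2, −1). -/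
theorem stmt_9 (x y f : ℤ) (hx : x > 0) (hy : y > 0) (hf : f < 0) :
    y*(y - 7) + x*(2*y - 5) + (-f)*(2*y - 4) + 2*(-f)*x = 0 ↔
      (x, y, f) = (2, 1, -6) ∨ (x, y, f) = (4, 1, -3) ∨ (x, y, f) = (10, 1, -2) ∨
      (x, y, f) = (2, 2, -3) ∨ (x, y, f) = (10, 2, -1) := by
  simp only [Prod.mk.injEq]
  constructor
  · intro h
    have hfx : 0 < (-f) * x := mul_pos (by omega) hx
    have hy4 : y ≤ 4 := by
      by_contra! hy5
      have h₁ : 5 ≤ x * (2 * y - 5) := by nlinarith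
      have h₂ : 6 ≤ (-f) * (2 * y - 4) := by nlinarith
      nlinarith [mul_nonneg (show 0 ≤ y - 5 by omega) (show 0 ≤ y - 2 by omega)]
    have hx10 : x ≤ 10 := by
      interval_cases y
      · have := Int.le_of_dvd (by norm_num)
          (show x - 1 ∣ 9 from ⟨2 * (-f) - 3, by linear_combination -h⟩)
        omega
      · exact Int.le_of_dvd (by norm_num) ⟨2 * (-f) - 1, by linear_combination -h⟩
      · nlinarith
      · nlinarith
    interval_cases y <;> interval_cases x <;> omega
  · rintro (⟨rfl, rfl, rfl⟩ | ⟨rfl, rfl, rfl⟩ | ⟨rfl, rfl, rfl⟩ | ⟨rfl, rfl, rfl⟩ |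
      ⟨rfl, rfl, rfl⟩) <;> norm_num
end

section
/- For nonnegative integers b, c, f, x with b + c ≥ 1 and bf = cx, the equation 2bx + (f − 4)b + cx + (2f − 4)c + x² + (f − 6)x + (f − 6)f = 0 holds if and only if (b, c, f, x) = (2, 0, 0, 4), (3, 3, 2, 2) or (0, 2, 4, 0). -/
theorem stmt_11 (b c f x : ℤ) (hb : b ≥ 0) (hc : c ≥ 0) (hf : f ≥ 0) (hx : x ≥ 0)
    (hbc : b + c ≥ 1) (hprop : b*f = c*x) :
    2*b*x + (f - 4)*b + c*x + (2*f - 4)*c + x^2 + (f - 6)*x + (f - 6)*f = 0 ↔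
      (b, c, f, x) = (2, 0, 0, 4) ∨ (b, c, f, x) = (3, 3, 2, 2) ∨
      (b, c, f, x) = (0, 2, 4, 0) := by
  simp only [Prod.mk.injEq]
  constructor
  · intro h
    have key : (x^2 + x*f + f^2) * (2*(b + c) + (x + f))
        = (x + f) * (4*(b + c) + 6*(x + f)) := by
      linear_combination (x + f) * h + (f - x) * hprop
    have hS : x + f ≤ 7 := by
      by_contra! hlt
      have hQ : 3 * (x + f)^2 ≤ 4 * (x^2 + x*f + f^2) := by nlinarith [sq_nonneg (x - f)]
      have hle := mul_le_mul_of_nonneg_right hQ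
        (by linarith : 0 ≤ 2*(b + c) + (x + f))
      have hcancel : 3 * (x + f) * (2*(b + c) + (x + f)) ≤ 16*(b + c) + 24*(x + f) := by
        refine le_of_mul_le_mul_left ?_ (by linarith : 0 < x + f)
        linarith
      nlinarith
    have hx7 : x ≤ 7 := by linarith
    have hf7 : f ≤ 7 := by linarith
    clear key
    interval_cases x <;> interval_cases f <;> omega
  · rintro (⟨rfl, rfl, rfl, rfl⟩ | ⟨rfl, rfl, rfl, rfl⟩ | ⟨rfl, rfl, rfl, rfl⟩) <;> norm_num
end

section
/- For integers a, x, y, z with a ≥ x ≥ y ≥ 1 and y + z ≥ 1, the equation z² + (2a + 2x + 2y − 6)z + 2ax + 2xy + 2ya − 4(a + x + y) = 0 holds if and only if (a, x, y, z) = (4, 2, 1, 0) or (a, x, y, z) = (2, 2, 2, 0). -/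
/-- With `a = A + 1`, `x = B + 1`, `y = C + 1`, `z = t - C`, the double-point equation becomes
this quadratic in `t`, all of whose nonnegative solutions are small. -/
lemma shifted_double_point_solutions {A B C t : ℤ} (hAB : B ≤ A) (hBC : C ≤ B) (hC : 0 ≤ C)
    (ht : 0 ≤ t) (h : t ^ 2 + 2 * (A + B) * t + 2 * A * B = C ^ 2 + 6) :
    (A = 3 ∧ B = 1 ∧ C = 0 ∧ t = 0) ∨ (A = 1 ∧ B = 1 ∧ C = 1 ∧ t = 1) := by
  have hBB : B * B ≤ A * B := mul_le_mul_of_nonneg_right hAB (by lia)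
  have hCC : C * C ≤ B * B := mul_le_mul hBC hBC hC (by lia)
  have hlin : 0 ≤ (A + B) * t := mul_nonneg (by lia) ht
  have ht2 : t ≤ 2 := by nlinarith
  have hB2 : B ≤ 2 := by nlinarith
  have hB0 : 0 ≤ B := hC.trans hBC
  have hC2 : C ≤ 2 := hBC.trans hB2
  interval_cases t <;> interval_cases B <;> interval_cases C <;> lia

theorem stmt_13 (a x y z : ℤ) (hax : a ≥ x) (hxy : x ≥ y) (hy : y ≥ 1)
    (hyz : y + z ≥ 1) :
    z^2 + (2*a + 2*x + 2*y - 6)*z + 2*a*x + 2*x*y + 2*y*a - 4*(a + x + y) = 0 ↔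
      (a, x, y, z) = (4, 2, 1, 0) ∨ (a, x, y, z) = (2, 2, 2, 0) := by
  simp only [Prod.mk.injEq]
  constructor
  · intro h
    have := shifted_double_point_solutions (A := a - 1) (B := x - 1) (C := y - 1)
      (t := y + z - 1) (by lia) (by lia) (by lia) (by lia) (by linear_combination h)
    lia
  · rintro (⟨rfl, rfl, rfl, rfl⟩ | ⟨rfl, rfl, rfl, rfl⟩) <;> norm_num
end

section
/- For nonnegative integers w, x, y, z with x ≥ y and x ≥ 1, the equation (2(x + y) + 6w − 6)z + (3w − 17)w + (6w − 11)(x + y) + (x + y)² + 4xy = 0 holds if and only if (w, x, y, z) is one of the ten quadruples (0, 2, 2, 6), (0, 3, 1, 8), (1, 2, 1, 2), (0, 6, 0, 5), (0, 11, 0, 0), (1, 1, 0, 9), (1, 1, 1, 4), (0, 4, 0, 14), (1, 7, 0, 0), (1, 2, 0, 5). -/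
theorem stmt_14 (w x y z : ℤ) (hw : w ≥ 0) (hx0 : x ≥ 0) (hy : y ≥ 0) (hz : z ≥ 0)
    (hxy : x ≥ y) (hx1 : x ≥ 1) :
    (2*(x + y) + 6*w - 6)*z + (3*w - 17)*w + (6*w - 11)*(x + y) + (x + y)^2 + 4*x*y = 0 ↔
      (w, x, y, z) = (0, 2, 2, 6) ∨ (w, x, y, z) = (0, 3, 1, 8) ∨
      (w, x, y, z) = (1, 2, 1, 2) ∨ (w, x, y, z) = (0, 6, 0, 5) ∨
      (w, x, y, z) = (0, 11, 0, 0) ∨ (w, x, y, z) = (1, 1, 0, 9) ∨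
      (w, x, y, z) = (1, 1, 1, 4) ∨ (w, x, y, z) = (0, 4, 0, 14) ∨
      (w, x, y, z) = (1, 7, 0, 0) ∨ (w, x, y, z) = (1, 2, 0, 5) := by
  simp only [Prod.mk.injEq]
  constructor
  · intro h
    have hxy0 : 0 ≤ x * y := mul_nonneg hx0 hy
    have hw5 : w ≤ 5 := by
      by_contra! hw6
      have hz0 : 0 ≤ (2*(x + y) + 6*w - 6)*z := mul_nonneg (by linarith) hz
      nlinarith [mul_nonneg (by linarith : 0 ≤ w - 6) hw,
        mul_nonneg (by linarith : 0 ≤ 6*w - 11) (add_nonneg hx0 hy), sq_nonneg (x + y)]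
    have hs : x + y ≤ 11 := by
      by_contra! hs12
      have hz0 : 0 ≤ (2*(x + y) + 6*w - 6)*z := mul_nonneg (by linarith) hz
      nlinarith [mul_nonneg hw (by linarith : 0 ≤ 6*(x + y) - 17), sq_nonneg w]
    have hx11 : x ≤ 11 := by linarith
    have hy5 : y ≤ 5 := by linarith
    interval_cases w <;> interval_cases x <;> interval_cases y <;> norm_num <;> omega
  · rintro (h | h | h | h | h | h | h | h | h | h) <;> obtain ⟨rfl, rfl, rfl, rfl⟩ := h <;> norm_num
end
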